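/- Let c, d, k > 0 be reals and let λ₁, λ₂ : ℕ → ℝ be sequences such that for every natural number n ≥ 1: λ₁(n) > λ₂(n) > 0, c · 2^n ≤ n / log₂(λ₁(n) / λ₂(n)), and n / (λ₁(n) − λ₂(n)) ≤ d · n^k. Then for every real ℓ > 0, the sequence λ₂(n) / n^ℓ tends to infinity as n → ∞; in particular λ₂ is not O(n^ℓ) for any ℓ, i.e., λ₂ grows super-polynomially. -/

import Mathlib

open Filter Real

/-- Exponentials with base `2` dominate real powers along the natural numbers. -/
theorem tendsto_two_rpow_div_rpow_atTop (s : ℝ) :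
    Tendsto (fun n : ℕ => (2 : ℝ) ^ (n : ℝ) / (n : ℝ) ^ s) atTop atTop := by
  refine ((tendsto_exp_mul_div_rpow_atTop s (Real.log 2) (Real.log_pos one_lt_two)).comp
    tendsto_natCast_atTop_atTop).congr fun n => ?_
  simp only [Function.comp_apply, Real.rpow_def_of_pos two_pos]

/-- If `0 < b < a` and `a / b ≤ 2`, then `a - b ≤ 2 * b * logb 2 (a / b)`. -/
theorem sub_le_two_mul_logb_div {a b : ℝ} (hb : 0 < b) (hab : b < a)
    (hL : Real.logb 2 (a / b) ≤ 1) : a - b ≤ 2 * b * Real.logb 2 (a / b) := by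
  have ha : 0 < a := hb.trans hab
  have hr : 1 < a / b := (one_lt_div hb).2 hab
  have hLpos : 0 < Real.logb 2 (a / b) := Real.logb_pos one_lt_two hr
  have hr2 : a ≤ 2 * b := by
    rw [Real.logb_le_iff_le_rpow one_lt_two (by positivity), Real.rpow_one, div_le_iff₀ hb] at hL
    exact hL
  have hlog : Real.log (a / b) ≤ Real.logb 2 (a / b) := by
    rw [← Real.log_div_log, le_div_iff₀ (Real.log_pos one_lt_two)]
    have := Real.log_two_lt_d9
    exact mul_le_of_le_one_right (Real.log_pos hr).le (by linarith)
  have h := (Real.one_sub_inv_le_log_of_pos (by positivity : 0 < a / b)).trans hlog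
  rw [inv_div, one_sub_div ha.ne', div_le_iff₀ ha] at h
  calc a - b ≤ Real.logb 2 (a / b) * a := h
    _ ≤ Real.logb 2 (a / b) * (2 * b) := by gcongr
    _ = 2 * b * Real.logb 2 (a / b) := by ring

/-- Theorem A.1 of the paper: if for all `n ≥ 1` the exponential-separation
criteria hold (`λ₁(n) > λ₂(n) > 0`, `c·2^n ≤ n / log₂(λ₁(n)/λ₂(n))`, and
`n/(λ₁(n) − λ₂(n)) ≤ d·n^k`), then `λ₂` grows super-polynomially:
for every `ℓ > 0`, `λ₂(n)/n^ℓ → ∞`. -/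
theorem stmt8 (c d k : ℝ) (hc : 0 < c) (hd : 0 < d) (hk : 0 < k)
    (lam1 lam2 : ℕ → ℝ)
    (hpos : ∀ n : ℕ, 1 ≤ n → 0 < lam2 n)
    (hlt : ∀ n : ℕ, 1 ≤ n → lam2 n < lam1 n)
    (h1 : ∀ n : ℕ, 1 ≤ n →
      c * (2 : ℝ) ^ (n : ℝ) ≤ (n : ℝ) / Real.logb 2 (lam1 n / lam2 n))
    (h2 : ∀ n : ℕ, 1 ≤ n →
      (n : ℝ) / (lam1 n - lam2 n) ≤ d * (n : ℝ) ^ k) :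
    ∀ ℓ : ℝ, 0 < ℓ →
      Tendsto (fun n : ℕ => lam2 n / (n : ℝ) ^ ℓ) atTop atTop := by
  intro ℓ _
  have hev : ∀ᶠ n : ℕ in atTop, (n : ℝ) ≤ c * (2 : ℝ) ^ (n : ℝ) := by
    filter_upwards [(tendsto_two_rpow_div_rpow_atTop 1).eventually_ge_atTop c⁻¹,
      eventually_ge_atTop 1] with n hn hn1
    have hn0 : (0 : ℝ) < n := by exact_mod_cast hn1
    rw [Real.rpow_one, le_div_iff₀ hn0, inv_mul_le_iff₀ hc] at hn
    exact hn
  refine tendsto_atTop_mono' _ ?_ ((tendsto_two_rpow_div_rpow_atTop (k + ℓ)).const_mul_atTop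
    (by positivity : 0 < c / (2 * d)))
  filter_upwards [hev, eventually_ge_atTop 1] with n hn hn1
  have hn0 : (0 : ℝ) < n := by exact_mod_cast hn1
  have hb := hpos n hn1
  have hab := hlt n hn1
  have hL : 0 < Real.logb 2 (lam1 n / lam2 n) :=
    Real.logb_pos one_lt_two ((one_lt_div hb).2 hab)
  have h1n := h1 n hn1
  have h2n := h2 n hn1
  rw [le_div_iff₀ hL] at h1n
  rw [div_le_iff₀ (sub_pos.2 hab)] at h2n
  have hL1 : Real.logb 2 (lam1 n / lam2 n) ≤ 1 := by
    have : (n : ℝ) * Real.logb 2 (lam1 n / lam2 n) ≤ n :=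
      (mul_le_mul_of_nonneg_right hn hL.le).trans h1n
    exact (mul_le_iff_le_one_right hn0).1 this
  have hsub := sub_le_two_mul_logb_div hb hab hL1
  have hkey : c * (2 : ℝ) ^ (n : ℝ) ≤ lam2 n * (2 * d * (n : ℝ) ^ k) := by
    refine le_of_mul_le_mul_right ?_ hL
    calc c * (2 : ℝ) ^ (n : ℝ) * Real.logb 2 (lam1 n / lam2 n) ≤ n := h1n
      _ ≤ d * (n : ℝ) ^ k * (lam1 n - lam2 n) := h2n
      _ ≤ d * (n : ℝ) ^ k * (2 * lam2 n * Real.logb 2 (lam1 n / lam2 n)) := by gcongr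
      _ = lam2 n * (2 * d * (n : ℝ) ^ k) * Real.logb 2 (lam1 n / lam2 n) := by ring
  rw [Real.rpow_add hn0, div_mul_div_comm, ← mul_assoc, ← div_div]
  gcongr
  rwa [div_le_iff₀ (by positivity)]
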